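/- Let n ≥ 1 and let λ, λ' be partitions of n with the same first part u, such that λ is strictly dominated by λ' (i.e., for every k, the sum of the first k parts of λ is at most that of λ', and λ ≠ λ'). Then f(λ) ≤ f(λ'), with equality if and only if u = 3 and both λ and λ' have all parts after the first at most 2. -/

import Mathlib

/-- The odd double factorial `(2k-1)!! = 1 * 3 * ... * (2k-1)`, with `odf 0 = 1`. -/
def odf (k : Nat) : Int := ∏ j ∈ Finset.Icc 1 k, (2 * (j : Int) - 1)

/-- Subtract `k` from every part, deleting parts that become zero. -/
def subHat (k : Nat) (l : List Nat) : List Nat :=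
  (l.map (fun x => x - k)).filter (fun x => x ≠ 0)

/-- `l` is a partition: a non-increasing list of positive integers. -/
def IsPartition (l : List Nat) : Prop := l.Chain' (· ≥ ·) ∧ ∀ x ∈ l, 0 < x

/-- Increase the `i`-th part (1-based indexing). -/
def upAt (i : Nat) (l : List Nat) : List Nat := l.set (i - 1) (l.getD (i - 1) 0 + 1)

/-- Decrease the `j`-th part (1-based indexing), deleting it if it becomes zero. -/
def downAt (j : Nat) (l : List Nat) : List Nat :=
  (l.set (j - 1) (l.getD (j - 1) 0 - 1)).filter (fun x => x ≠ 0)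

section

open MvPolynomial

/-- The linear functional `E` with `E (∏ X i ^ k i) = ∏ (2 k i - 1)!!`, the expectation for
independent chi-square variables `X i`. -/
noncomputable def chiExp : MvPolynomial ℕ ℤ →ₗ[ℤ] ℤ :=
  (basisMonomials ℕ ℤ).constr ℤ fun m => m.prod fun _ k => odf k

lemma odf_zero : odf 0 = 1 := by simp [odf]

lemma odf_succ (k : ℕ) : odf (k + 1) = (2 * k + 1) * odf k := by
  unfold odf
  rw [Finset.prod_Icc_succ_top (by omega)]
  push_cast
  ring

lemma chiExp_monomial (m : ℕ →₀ ℕ) (c : ℤ) :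
    chiExp (monomial m c) = c * m.prod fun _ k => odf k := by
  have h : (monomial m c : MvPolynomial ℕ ℤ) = c • basisMonomials ℕ ℤ m := by
    simp [smul_monomial]
  rw [h, map_smul, chiExp, Module.Basis.constr_basis, smul_eq_mul]

lemma chiExp_one : chiExp 1 = 1 := by
  have := chiExp_monomial 0 1
  simpa using this

/-- Integration by parts. -/
lemma chiExp_X_mul (k : ℕ) (p : MvPolynomial ℕ ℤ) :
    chiExp (X k * p) = chiExp p + 2 * chiExp (X k * pderiv k p) := by
  induction p using MvPolynomial.induction_on' with
  | monomial m c =>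
    have key : (m + Finsupp.single k 1).prod (fun _ j => odf j)
        = (2 * (m k : ℤ) + 1) * m.prod fun _ j => odf j := by
      have hs (q : ℕ →₀ ℕ) : q.prod (fun _ j => odf j)
          = odf (q k) * (q.erase k).prod fun _ j => odf j := by
        exact (Finsupp.mul_prod_erase' q k (fun _ j => odf j) fun _ => odf_zero).symm
      rw [hs, hs m]
      simp only [Finsupp.erase_add, Finsupp.erase_single, add_zero, Finsupp.add_apply,
        Finsupp.single_eq_same, odf_succ]
      ring
    rw [mul_comm (X k) (monomial m c), ← pow_one (X k : MvPolynomial ℕ ℤ),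
      ← monomial_add_single, pow_one, chiExp_monomial, chiExp_monomial, key, pderiv_monomial]
    rcases Nat.eq_zero_or_pos (m k) with h | h
    · simp [h]
    · have e : m - Finsupp.single k 1 + Finsupp.single k 1 = m := by
        apply tsub_add_cancel_of_le
        simpa using Nat.one_le_iff_ne_zero.2 h.ne'
      rw [mul_comm (X k), ← pow_one (X k : MvPolynomial ℕ ℤ), ← monomial_add_single, e,
        chiExp_monomial]
      ring
  | add p q hp hq =>
    simp only [mul_add, map_add, hp, hq]
    ring

/-- `X 0 + ⋯ + X (t - 1) - 1`. -/
noncomputable def shiftSum (t : ℕ) : MvPolynomial ℕ ℤ := ∑ k ∈ Finset.range t, X k - 1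

lemma shiftSum_succ (t : ℕ) : shiftSum (t + 1) = shiftSum t + X t := by
  simp only [shiftSum, Finset.sum_range_succ]
  ring

lemma pderiv_shiftSum (k t : ℕ) : pderiv k (shiftSum t) = if k < t then 1 else 0 := by
  induction t with
  | zero => simp [shiftSum]
  | succ t ih =>
    rw [shiftSum_succ, map_add, ih, pderiv_X]
    rcases lt_trichotomy k t with h | rfl | h
    · simp [h, h.ne', Nat.lt_succ_of_lt h]
    · simp
    · simp [h.ne, not_lt.2 h.le, show ¬ k < t + 1 by omega]

/-- The product of `shiftSum (h i)` over `i ∈ s`. -/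
noncomputable def colProd (h : ℕ → ℕ) (s : Finset ℕ) : MvPolynomial ℕ ℤ :=
  ∏ i ∈ s, shiftSum (h i)

lemma colProd_erase (h : ℕ → ℕ) {s : Finset ℕ} {i : ℕ} (hi : i ∈ s) :
    colProd h s = shiftSum (h i) * colProd h (s.erase i) :=
  (Finset.mul_prod_erase s _ hi).symm

lemma pderiv_colProd (h : ℕ → ℕ) (k : ℕ) (s : Finset ℕ) :
    pderiv k (colProd h s) = ∑ i ∈ s, if k < h i then colProd h (s.erase i) else 0 := by
  induction s using Finset.induction_on with
  | empty => simp [colProd]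
  | insert a s ha ih =>
    have e : colProd h (insert a s) = shiftSum (h a) * colProd h s := Finset.prod_insert ha
    rw [e, pderiv_mul, ih, pderiv_shiftSum, Finset.sum_insert ha, Finset.erase_insert ha,
      Finset.mul_sum]
    congr 1
    · split_ifs <;> simp
    · refine Finset.sum_congr rfl fun i hi => ?_
      have hai : a ≠ i := by rintro rfl; exact ha hi
      have e' : colProd h ((insert a s).erase i) = shiftSum (h a) * colProd h (s.erase i) := by
        rw [Finset.erase_insert_of_ne hai]
        exact Finset.prod_insert fun h' => ha (Finset.mem_of_mem_erase h')
      rw [e']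
      split_ifs <;> simp

lemma chiExp_X_mul_colProd (h : ℕ → ℕ) (k : ℕ) (s : Finset ℕ) :
    chiExp (X k * colProd h s) = chiExp (colProd h s)
      + 2 * ∑ i ∈ s, if k < h i then chiExp (X k * colProd h (s.erase i)) else 0 := by
  rw [chiExp_X_mul, pderiv_colProd, Finset.mul_sum, map_sum]
  congr 2
  refine Finset.sum_congr rfl fun i _ => ?_
  split_ifs <;> simp

lemma chiExp_shiftSum_mul (t : ℕ) (p : MvPolynomial ℕ ℤ) :
    chiExp (shiftSum t * p) = ∑ k ∈ Finset.range t, chiExp (X k * p) - chiExp p := by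
  rw [shiftSum, sub_mul, one_mul, map_sub, Finset.sum_mul, map_sum]

lemma chiExp_colProd_nonneg (h : ℕ → ℕ) (s : Finset ℕ) (hs : ∀ i ∈ s, 1 ≤ h i) :
    0 ≤ chiExp (colProd h s) ∧ ∀ k, chiExp (colProd h s) ≤ chiExp (X k * colProd h s) := by
  induction s using Finset.strongInduction with
  | H s ih =>
    have ih' : ∀ i ∈ s, 0 ≤ chiExp (colProd h (s.erase i)) ∧
        ∀ k, chiExp (colProd h (s.erase i)) ≤ chiExp (X k * colProd h (s.erase i)) :=
      fun i hi => ih _ (Finset.erase_ssubset hi) fun j hj => hs j (Finset.mem_of_mem_erase hj)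
    constructor
    · rcases s.eq_empty_or_nonempty with rfl | ⟨i, hi⟩
      · simp [colProd, chiExp_one]
      · obtain ⟨h0, h1⟩ := ih' i hi
        rw [colProd_erase h hi, chiExp_shiftSum_mul]
        have : chiExp (X 0 * colProd h (s.erase i))
            ≤ ∑ k ∈ Finset.range (h i), chiExp (X k * colProd h (s.erase i)) :=
          Finset.single_le_sum (f := fun k => chiExp (X k * colProd h (s.erase i)))
            (fun k _ => h0.trans (h1 k)) (Finset.mem_range.2 (hs i hi))
        linarith [h1 0]
    · intro k
      rw [chiExp_X_mul_colProd]
      have : 0 ≤ ∑ i ∈ s, if k < h i then chiExp (X k * colProd h (s.erase i)) else 0 := by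
        refine Finset.sum_nonneg fun i hi => ?_
        split_ifs
        · exact (ih' i hi).1.trans ((ih' i hi).2 k)
        · rfl
      linarith

lemma two_mul_le_chiExp_X_zero_mul (h : ℕ → ℕ) (s : Finset ℕ) (hs : ∀ i ∈ s, 1 ≤ h i)
    {j : ℕ} (hj : j ∈ s) :
    chiExp (colProd h s) + 2 * chiExp (X 0 * colProd h (s.erase j))
      ≤ chiExp (X 0 * colProd h s) := by
  rw [chiExp_X_mul_colProd h 0 s]
  have := Finset.single_le_sum
    (f := fun i => if 0 < h i then chiExp (X 0 * colProd h (s.erase i)) else 0)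
    (fun i _ => by
      have := chiExp_colProd_nonneg h (s.erase i) fun j hj => hs j (Finset.mem_of_mem_erase hj)
      split_ifs
      · exact this.1.trans (this.2 0)
      · rfl) hj
  simp only [show 0 < h j from hs j hj, if_true] at this
  linarith

lemma chiExp_X_zero_mul_pos (h : ℕ → ℕ) (s : Finset ℕ) (hs : ∀ i ∈ s, 1 ≤ h i) :
    0 < chiExp (X 0 * colProd h s) := by
  induction s using Finset.strongInduction with
  | H s ih =>
    rcases s.eq_empty_or_nonempty with rfl | ⟨i, hi⟩
    · rw [chiExp_X_mul]
      simp [colProd, chiExp_one]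
    · have h1 := ih _ (Finset.erase_ssubset hi) fun j hj => hs j (Finset.mem_of_mem_erase hj)
      have h2 := two_mul_le_chiExp_X_zero_mul h s hs hi
      linarith [(chiExp_colProd_nonneg h s hs).1]

lemma chiExp_X (k : ℕ) : chiExp (X k) = 1 := by
  have := chiExp_X_mul k 1
  simpa [chiExp_one] using this

lemma chiExp_shiftSum (t : ℕ) : chiExp (shiftSum t) = t - 1 := by
  have := chiExp_shiftSum_mul t 1
  simpa [chiExp_one, chiExp_X] using this

lemma chiExp_colProd_pos (h : ℕ → ℕ) (s : Finset ℕ) (hs : ∀ i ∈ s, 1 ≤ h i)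
    (h2 : ∀ i, s = {i} → 2 ≤ h i) : 0 < chiExp (colProd h s) := by
  rcases s.eq_empty_or_nonempty with rfl | ⟨i, hi⟩
  · simp [colProd, chiExp_one]
  · rcases (s.erase i).eq_empty_or_nonempty with he | ⟨j, hj⟩
    · have : s = {i} := by
        rw [← Finset.insert_erase hi, he]; rfl
      have h3 := h2 i this
      rw [this]
      simp only [colProd, Finset.prod_singleton, chiExp_shiftSum]
      have : (2 : ℤ) ≤ h i := by exact_mod_cast h3
      linarith
    · have hs' : ∀ l ∈ s.erase i, 1 ≤ h l := fun l hl => hs l (Finset.mem_of_mem_erase hl)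
      rw [colProd_erase h hi, chiExp_shiftSum_mul]
      have h1 := chiExp_colProd_nonneg h (s.erase i) hs'
      have h3 : chiExp (X 0 * colProd h (s.erase i))
          ≤ ∑ k ∈ Finset.range (h i), chiExp (X k * colProd h (s.erase i)) :=
        Finset.single_le_sum (f := fun k => chiExp (X k * colProd h (s.erase i)))
          (fun k _ => h1.1.trans (h1.2 k)) (Finset.mem_range.2 (hs i hi))
      have h4 := two_mul_le_chiExp_X_zero_mul h _ hs' hj
      have h5 := chiExp_X_zero_mul_pos h ((s.erase i).erase j)
        fun l hl => hs' l (Finset.mem_of_mem_erase hl)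
      linarith

lemma chiExp_X_mul_colProd_anti (h : ℕ → ℕ) (s : Finset ℕ) (hs : ∀ i ∈ s, 1 ≤ h i)
    {k l : ℕ} (hkl : k ≤ l) :
    chiExp (X l * colProd h s) ≤ chiExp (X k * colProd h s) := by
  induction s using Finset.strongInduction with
  | H s ih =>
    rw [chiExp_X_mul_colProd, chiExp_X_mul_colProd]
    have : (∑ i ∈ s, if l < h i then chiExp (X l * colProd h (s.erase i)) else 0)
        ≤ ∑ i ∈ s, if k < h i then chiExp (X k * colProd h (s.erase i)) else 0 := by
      refine Finset.sum_le_sum fun i hi => ?_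
      have hs' : ∀ l ∈ s.erase i, 1 ≤ h l := fun l hl => hs l (Finset.mem_of_mem_erase hl)
      have h1 := ih _ (Finset.erase_ssubset hi) hs'
      have h2 := chiExp_colProd_nonneg h _ hs'
      have h3 := h2.2 k
      split_ifs <;> omega
    linarith

lemma chiExp_X_mul_X_mul_colProd (h : ℕ → ℕ) (s : Finset ℕ) (hs : ∀ i ∈ s, 1 ≤ h i)
    (k l : ℕ) : chiExp (X k * colProd h s) ≤ chiExp (X k * (X l * colProd h s)) := by
  induction s using Finset.strongInduction with
  | H s ih =>
    have e : X k * (X l * colProd h s) = X l * (X k * colProd h s) := by ring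
    have h0 := chiExp_colProd_nonneg h s hs
    have hd : X l * pderiv l (X k * colProd h s)
        = (if k = l then 1 else 0) * (X l * colProd h s)
          + ∑ i ∈ s, if l < h i then X k * (X l * colProd h (s.erase i)) else 0 := by
      rw [Derivation.leibniz, pderiv_X, pderiv_colProd]
      simp only [smul_eq_mul, Pi.single_apply, mul_add, Finset.mul_sum]
      rw [add_comm]
      congr 1
      · split_ifs <;> simp_all
      · refine Finset.sum_congr rfl fun i _ => ?_
        split_ifs
        · ring
        · simp
    rw [e, chiExp_X_mul l, hd, map_add, map_sum]
    have h1 : 0 ≤ chiExp ((if k = l then 1 else 0) * (X l * colProd h s)) := by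
      split_ifs
      · rw [one_mul]; exact h0.1.trans (h0.2 l)
      · simp
    have h2 : 0 ≤ ∑ i ∈ s,
        chiExp (if l < h i then X k * (X l * colProd h (s.erase i)) else 0) := by
      refine Finset.sum_nonneg fun i hi => ?_
      have hs' : ∀ l ∈ s.erase i, 1 ≤ h l := fun l hl => hs l (Finset.mem_of_mem_erase hl)
      have h3 := chiExp_colProd_nonneg h _ hs'
      split_ifs
      · exact (h3.1.trans (h3.2 k)).trans (ih _ (Finset.erase_ssubset hi) hs')
      · simp
    linarith

lemma shiftSum_add (b m : ℕ) :
    shiftSum (b + m) = shiftSum b + ∑ k ∈ Finset.range m, X (b + k) := by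
  induction m with
  | zero => simp
  | succ m ih => rw [← add_assoc, shiftSum_succ, ih, Finset.sum_range_succ]; ring

/-- Moving one unit from a column to one shorter by at least two increases the expectation. -/
lemma chiExp_colProd_transfer (h : ℕ → ℕ) (s : Finset ℕ) (hs : ∀ i ∈ s, 1 ≤ h i)
    {i j : ℕ} (hi : i ∈ s) (hj : j ∈ s) (hij : h j + 2 ≤ h i) :
    chiExp (colProd h s) + chiExp (colProd h ((s.erase i).erase j))
      ≤ chiExp (colProd (Function.update (Function.update h i (h i - 1)) j (h j + 1)) s) := by
  have hne : j ≠ i := by rintro rfl; omega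
  have hj' : j ∈ s.erase i := Finset.mem_erase.2 ⟨hne, hj⟩
  set h' := Function.update (Function.update h i (h i - 1)) j (h j + 1) with hh'
  set T := (s.erase i).erase j with hT
  have hP : colProd h' T = colProd h T := by
    refine Finset.prod_congr rfl fun l hl => ?_
    have h1 : l ≠ j := (Finset.mem_erase.1 hl).1
    have h2 : l ≠ i := (Finset.mem_erase.1 (Finset.mem_erase.1 hl).2).1
    simp [hh', h1, h2]
  have hi' : h' i = h i - 1 := by simp [hh', hne.symm]
  have hjj : h' j = h j + 1 := by simp [hh']
  obtain ⟨m, hm⟩ : ∃ m, h i = h j + (m + 1) + 1 := ⟨h i - h j - 2, by omega⟩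
  have hs1 : ∀ l ∈ s.erase i, 1 ≤ h l := fun l hl => hs l (Finset.mem_of_mem_erase hl)
  have hs2 : ∀ l ∈ T, 1 ≤ h l := fun l hl => hs1 l (Finset.mem_of_mem_erase hl)
  have e : colProd h' s = colProd h s
      + (X (h j) * colProd h (s.erase i) - X (h j + (m + 1)) * colProd h (s.erase i))
      + ∑ k ∈ Finset.range (m + 1), X (h j) * (X (h j + k) * colProd h T) := by
    rw [colProd_erase h' hi, colProd_erase h' hj', hP, colProd_erase h hi, colProd_erase h hj',
      hi', hjj, hm, Nat.add_sub_cancel, shiftSum_succ, shiftSum_succ, shiftSum_add,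
      ← Finset.mul_sum, ← Finset.sum_mul]
    ring
  have h1 := chiExp_X_mul_colProd_anti h (s.erase i) hs1 (show h j ≤ h j + (m + 1) by omega)
  have h2 := chiExp_colProd_nonneg h T hs2
  have h3 : chiExp (X (h j) * (X (h j + 0) * colProd h T))
      ≤ ∑ k ∈ Finset.range (m + 1), chiExp (X (h j) * (X (h j + k) * colProd h T)) :=
    Finset.single_le_sum (f := fun k => chiExp (X (h j) * (X (h j + k) * colProd h T)))
      (fun k _ => (h2.1.trans (h2.2 _)).trans (chiExp_X_mul_X_mul_colProd h T hs2 _ _))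
      (Finset.mem_range.2 (Nat.succ_pos m))
  have h4 := chiExp_X_mul_X_mul_colProd h T hs2 (h j) (h j + 0)
  have h5 := h2.2 (h j)
  rw [e, map_add, map_add, map_sub, map_sum]
  linarith

lemma card_filter_eq_add_two_mul_sum (h : ℕ → ℕ) (s : Finset ℕ) (c : ℕ) :
    (s.filter fun i => h i = c + 1).card + 2 * ∑ i ∈ s, (h i - (c + 1))
      = ∑ i ∈ s, (h i - c) + ∑ i ∈ s, (h i - (c + 2)) := by
  rw [Finset.card_filter, Finset.mul_sum, ← Finset.sum_add_distrib, ← Finset.sum_add_distrib]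
  refine Finset.sum_congr rfl fun i _ => ?_
  split_ifs <;> omega

lemma card_filter_eq_of_sum_sub_eq {h h' : ℕ → ℕ} {s : Finset ℕ}
    (heq : ∀ c, ∑ i ∈ s, (h' i - c) = ∑ i ∈ s, (h i - c)) (c : ℕ) :
    (s.filter fun i => h i = c + 1).card = (s.filter fun i => h' i = c + 1).card := by
  have h1 := card_filter_eq_add_two_mul_sum h s c
  have h2 := card_filter_eq_add_two_mul_sum h' s c
  rw [heq, heq, heq] at h2
  omega

lemma colProd_eq_of_sum_sub_eq {h h' : ℕ → ℕ} {s : Finset ℕ} (hs : ∀ i ∈ s, 1 ≤ h i)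
    (hs' : ∀ i ∈ s, 1 ≤ h' i) (heq : ∀ c, ∑ i ∈ s, (h' i - c) = ∑ i ∈ s, (h i - c)) :
    colProd h s = colProd h' s := by
  have hm : s.val.map h = s.val.map h' := by
    ext v
    rw [Multiset.count_map, Multiset.count_map]
    rcases v with _ | c
    · rw [Multiset.filter_eq_nil.2, Multiset.filter_eq_nil.2]
      · intro i hi h0
        have := hs' i hi
        omega
      · intro i hi h0
        have := hs i hi
        omega
    · have := card_filter_eq_of_sum_sub_eq heq c
      simpa only [Finset.card, Finset.filter_val, eq_comm] using this
  have key (g : ℕ → ℕ) : colProd g s = ((s.val.map g).map shiftSum).prod := by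
    rw [Multiset.map_map]; rfl
  rw [key, key, hm]

lemma sum_eq_add_add_sum_erase {M : Type*} [AddCommMonoid M] (g : ℕ → M) {s : Finset ℕ} {i j : ℕ}
    (hi : i ∈ s) (hj : j ∈ s.erase i) :
    ∑ l ∈ s, g l = g i + (g j + ∑ l ∈ (s.erase i).erase j, g l) := by
  rw [Finset.add_sum_erase _ _ hj, Finset.add_sum_erase _ _ hi]

/-- If the excesses of `h` dominate those of `h'` strictly somewhere, some unit transfer on `h`
preserves domination. -/
lemma exists_transfer {h h' : ℕ → ℕ} {s : Finset ℕ} (hs : ∀ i ∈ s, 1 ≤ h i)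
    (hs' : ∀ i ∈ s, 1 ≤ h' i) (hdom : ∀ c, ∑ i ∈ s, (h' i - c) ≤ ∑ i ∈ s, (h i - c))
    (hsum : ∑ i ∈ s, h' i = ∑ i ∈ s, h i)
    (hlt : ∃ c, ∑ i ∈ s, (h' i - c) < ∑ i ∈ s, (h i - c)) :
    ∃ i ∈ s, ∃ j ∈ s, h j + 2 ≤ h i ∧
      ∀ c, h j < c → c < h i → ∑ l ∈ s, (h' l - c) < ∑ l ∈ s, (h l - c) := by
  classical
  have hone (g : ℕ → ℕ) (hg : ∀ i ∈ s, 1 ≤ g i) : ∑ i ∈ s, (g i - 1) + s.card = ∑ i ∈ s, g i := by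
    rw [Finset.card_eq_sum_ones, ← Finset.sum_add_distrib]
    exact Finset.sum_congr rfl fun i hi => Nat.sub_add_cancel (hg i hi)
  obtain ⟨c₀, hc₀, hmin⟩ : ∃ c, (∑ i ∈ s, (h' i - c) < ∑ i ∈ s, (h i - c)) ∧
      ∀ m < c, ¬ ∑ i ∈ s, (h' i - m) < ∑ i ∈ s, (h i - m) :=
    ⟨Nat.find hlt, Nat.find_spec hlt, fun m hm => Nat.find_min hlt hm⟩
  have h2 : 2 ≤ c₀ := by
    by_contra! hc
    interval_cases c₀
    · simp only [Nat.sub_zero] at hc₀; omega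
    · have := hone h hs
      have := hone h' hs'
      omega
  obtain ⟨b, rfl⟩ : ∃ b, c₀ = b + 2 := ⟨c₀ - 2, by omega⟩
  have hex : ∃ m, ∑ i ∈ s, (h i - (b + 3 + m)) ≤ ∑ i ∈ s, (h' i - (b + 3 + m)) := by
    refine ⟨∑ i ∈ s, h i, ?_⟩
    rw [Finset.sum_eq_zero]
    · exact Nat.zero_le _
    · intro i hi
      have := Finset.single_le_sum (f := h) (fun _ _ => Nat.zero_le _) hi
      omega
  obtain ⟨m, hm, hmmin⟩ : ∃ m, (∑ i ∈ s, (h i - (b + 3 + m)) ≤ ∑ i ∈ s, (h' i - (b + 3 + m))) ∧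
      ∀ k < m, ¬ ∑ i ∈ s, (h i - (b + 3 + k)) ≤ ∑ i ∈ s, (h' i - (b + 3 + k)) :=
    ⟨Nat.find hex, Nat.find_spec hex, fun m hm => Nat.find_min hex hm⟩
  have hstrict : ∀ c, b + 2 ≤ c → c < b + 3 + m →
      ∑ l ∈ s, (h' l - c) < ∑ l ∈ s, (h l - c) := by
    intro c hc1 hc2
    rcases hc1.eq_or_lt with rfl | hc1
    · exact hc₀
    · obtain ⟨k, rfl⟩ : ∃ k, c = b + 3 + k := ⟨c - (b + 3), by omega⟩
      exact not_le.1 (hmmin k (by omega))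
  have hj : 0 < (s.filter fun i => h i = b + 1).card := by
    have e1 := card_filter_eq_add_two_mul_sum h s b
    have e2 := card_filter_eq_add_two_mul_sum h' s b
    have e3 := hdom b
    have e4 := hmin (b + 1) (by omega)
    omega
  have hi : 0 < (s.filter fun i => h i = b + 3 + m).card := by
    have e1 := card_filter_eq_add_two_mul_sum h s (b + 2 + m)
    have e2 := card_filter_eq_add_two_mul_sum h' s (b + 2 + m)
    have e3 := hdom (b + 2 + m + 2)
    have e4 := hstrict (b + 2 + m) (by omega) (by omega)
    rw [show b + 3 + m = b + 2 + m + 1 by omega] at hm ⊢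
    omega
  obtain ⟨i, hi⟩ := Finset.card_pos.1 hi
  obtain ⟨j, hj⟩ := Finset.card_pos.1 hj
  rw [Finset.mem_filter] at hi hj
  exact ⟨i, hi.1, j, hj.1, by omega, fun c h1 h2 => hstrict c (by omega) (by omega)⟩

/-- The expectation of `colProd` is Schur-concave in the column heights, strictly so unless there
are three columns, one of height one. -/
lemma chiExp_colProd_le_of_dom (s : Finset ℕ) (h' : ℕ → ℕ) (hs' : ∀ i ∈ s, 1 ≤ h' i)
    (h : ℕ → ℕ) (hs : ∀ i ∈ s, 1 ≤ h i)
    (hdom : ∀ c, ∑ i ∈ s, (h' i - c) ≤ ∑ i ∈ s, (h i - c))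
    (hsum : ∑ i ∈ s, h' i = ∑ i ∈ s, h i) :
    chiExp (colProd h s) ≤ chiExp (colProd h' s) ∧
      ((∃ c, ∑ i ∈ s, (h' i - c) < ∑ i ∈ s, (h i - c)) → ¬ (s.card = 3 ∧ ∃ i ∈ s, h' i = 1) →
        chiExp (colProd h s) < chiExp (colProd h' s)) := by
  induction hN : ∑ i ∈ s, h i ^ 2 using Nat.strong_induction_on generalizing h with
  | _ N ih =>
  subst hN
  by_cases hlt : ∃ c, ∑ i ∈ s, (h' i - c) < ∑ i ∈ s, (h i - c)
  swap
  · refine ⟨?_, fun h1 => absurd h1 hlt⟩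
    push Not at hlt
    rw [colProd_eq_of_sum_sub_eq hs hs' fun c => le_antisymm (hdom c) (hlt c)]
  obtain ⟨i, hi, j, hj, hij, hstrict⟩ := exists_transfer hs hs' hdom hsum hlt
  have hne : j ≠ i := by rintro rfl; omega
  have hj' : j ∈ s.erase i := Finset.mem_erase.2 ⟨hne, hj⟩
  have htr := chiExp_colProd_transfer h s hs hi hj hij
  set T := (s.erase i).erase j with hT
  set g := Function.update (Function.update h i (h i - 1)) j (h j + 1) with hg
  have gi : g i = h i - 1 := by simp [hg, hne.symm]
  have gj : g j = h j + 1 := by simp [hg]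
  have gT : ∀ l ∈ T, g l = h l := by
    intro l hl
    have h1 : l ≠ j := (Finset.mem_erase.1 hl).1
    have h2 : l ≠ i := (Finset.mem_erase.1 (Finset.mem_erase.1 hl).2).1
    simp [hg, h1, h2]
  have hgs : ∀ l ∈ s, 1 ≤ g l := by
    intro l hl
    by_cases h1 : l = j
    · rw [h1, gj]; omega
    · by_cases h2 : l = i
      · rw [h2, gi]; omega
      · rw [gT l (Finset.mem_erase.2 ⟨h1, Finset.mem_erase.2 ⟨h2, hl⟩⟩)]
        exact hs l hl
  have hgsum (φ : ℕ → ℕ) : ∑ l ∈ s, φ (g l)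
      = φ (h i - 1) + (φ (h j + 1) + ∑ l ∈ T, φ (h l)) := by
    rw [sum_eq_add_add_sum_erase _ hi hj', gi, gj]
    congr 2
    exact Finset.sum_congr rfl fun l hl => by rw [gT l hl]
  have hhsum (φ : ℕ → ℕ) : ∑ l ∈ s, φ (h l) = φ (h i) + (φ (h j) + ∑ l ∈ T, φ (h l)) :=
    sum_eq_add_add_sum_erase _ hi hj'
  have hgdom : ∀ c, ∑ l ∈ s, (h' l - c) ≤ ∑ l ∈ s, (g l - c) := by
    intro c
    have e0 := hdom c
    have e1 := hgsum (· - c)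
    have e2 := hhsum (· - c)
    have e3 := hstrict c
    omega
  have hgsum' : ∑ l ∈ s, h' l = ∑ l ∈ s, g l := by
    have e1 := hgsum id
    have e2 := hhsum id
    simp only [id] at e1 e2
    omega
  have hsq : ∑ l ∈ s, g l ^ 2 < ∑ l ∈ s, h l ^ 2 := by
    rw [hgsum (· ^ 2), hhsum (· ^ 2)]
    obtain ⟨m, hm⟩ : ∃ m, h i = h j + 2 + m := ⟨h i - (h j + 2), by omega⟩
    rw [hm, show h j + 2 + m - 1 = h j + 1 + m by omega]
    nlinarith
  obtain ⟨ih1, ih2⟩ := ih _ hsq g hgs hgdom hgsum' rfl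
  have hTs : ∀ l ∈ T, 1 ≤ h l :=
    fun l hl => hs l (Finset.mem_of_mem_erase (Finset.mem_of_mem_erase hl))
  have hT0 := (chiExp_colProd_nonneg h T hTs).1
  refine ⟨by linarith, fun _ hex => ?_⟩
  by_cases hpos : 0 < chiExp (colProd h T)
  · linarith
  have hl : ∃ l, T = {l} ∧ h l < 2 := by
    by_contra! hcon
    exact hpos (chiExp_colProd_pos h T hTs hcon)
  obtain ⟨l, hTl, hl2⟩ := hl
  have hlT : l ∈ T := by simp [hTl]
  have hls : l ∈ s := Finset.mem_of_mem_erase (Finset.mem_of_mem_erase hlT)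
  have hgl : g l = 1 := by
    have := hTs l hlT
    rw [gT l hlT]; omega
  have hcard : s.card = 3 := by
    have h1 := Finset.card_erase_add_one hi
    have h2 := Finset.card_erase_add_one hj'
    rw [← hT, hTl, Finset.card_singleton] at h2
    omega
  have hlt' : ∃ c, ∑ i ∈ s, (h' i - c) < ∑ i ∈ s, (g i - c) := by
    by_contra! hle
    have h1 := card_filter_eq_of_sum_sub_eq (fun c => le_antisymm (hgdom c) (hle c)) 0
    have h2 : 0 < (s.filter fun i => g i = 0 + 1).card :=
      Finset.card_pos.2 ⟨l, Finset.mem_filter.2 ⟨hls, hgl⟩⟩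
    rw [h1] at h2
    obtain ⟨k, hk⟩ := Finset.card_pos.1 h2
    rw [Finset.mem_filter] at hk
    exact hex ⟨hcard, k, hk⟩
  linarith [ih2 hlt' hex]

lemma chiExp_shiftSum_one_mul {a b : ℕ} (ha : 1 ≤ a) (hb : 1 ≤ b) :
    chiExp (shiftSum 1 * (shiftSum a * shiftSum b)) = 2 * (a + b + 2) := by
  have h1 (t : ℕ) (ht : 1 ≤ t) : chiExp (X 0 * shiftSum t) = t + 1 := by
    rw [chiExp_X_mul, pderiv_shiftSum, chiExp_shiftSum, if_pos (show 0 < t from ht),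
      mul_one, chiExp_X]
    ring
  rw [chiExp_shiftSum_mul, Finset.sum_range_one, chiExp_X_mul, pderiv_mul, pderiv_shiftSum,
    pderiv_shiftSum, if_pos (show 0 < a from ha), if_pos (show 0 < b from hb), one_mul, mul_one,
    mul_add, map_add, h1 _ ha, h1 _ hb]
  ring

/-- The number of parts of `l` exceeding `j`. -/
def colHeight (l : List ℕ) (j : ℕ) : ℕ := l.countP (j < ·)

lemma colHeight_cons (x : ℕ) (l : List ℕ) (j : ℕ) :
    colHeight (x :: l) j = colHeight l j + if j < x then 1 else 0 := by
  simp [colHeight, List.countP_cons]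

lemma colHeight_eq_zero_iff (l : List ℕ) (j : ℕ) : colHeight l j = 0 ↔ ∀ x ∈ l, x ≤ j := by
  simp [colHeight, List.countP_eq_zero]

lemma sum_colHeight_sub_add (u : ℕ) (l : List ℕ) (hl : l.Pairwise (· ≥ ·))
    (hu : ∀ x ∈ l, x ≤ u) (c : ℕ) :
    ∑ j ∈ Finset.range u, (colHeight l j - c) + ∑ t ∈ Finset.range c, l.getD t 0 = l.sum := by
  induction l generalizing c with
  | nil => simp [colHeight]
  | cons x l ih =>
    have hl' := List.pairwise_cons.1 hl
    have hxu : x ≤ u := hu x (by simp)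
    have ih' := ih hl'.2 fun y hy => hu y (by simp [hy])
    have e := colHeight_cons x l
    have e0 (j : ℕ) (hj : x ≤ j) : colHeight l j = 0 :=
      (colHeight_eq_zero_iff l j).2 fun y hy => (hl'.1 y hy).trans hj
    rcases c with _ | c
    · have h1 : ∑ j ∈ Finset.range u, (if j < x then 1 else 0) = x := by
        rw [← Finset.card_filter]
        have : (Finset.range u).filter (· < x) = Finset.range x := by
          ext j; simp only [Finset.mem_filter, Finset.mem_range]; omega
        rw [this, Finset.card_range]
      have h2 := ih' 0
      simp only [Nat.sub_zero, Finset.range_zero, Finset.sum_empty, add_zero, e,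
        Finset.sum_add_distrib, h1, List.sum_cons] at h2 ⊢
      omega
    · rw [Finset.sum_range_succ']
      have h1 : ∑ j ∈ Finset.range u, (colHeight (x :: l) j - (c + 1))
          = ∑ j ∈ Finset.range u, (colHeight l j - c) := by
        refine Finset.sum_congr rfl fun j _ => ?_
        rw [e]
        split_ifs with hj
        · omega
        · rw [e0 j (not_lt.1 hj)]; omega
      have h2 := ih' c
      simp only [h1, List.getD_cons_succ, List.getD_cons_zero, List.sum_cons]
      omega

lemma IsPartition.pairwise {l : List ℕ} (hl : IsPartition l) : l.Pairwise (· ≥ ·) :=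
  List.isChain_iff_pairwise.1 hl.1

lemma isPartition_iff {l : List ℕ} : IsPartition l ↔ l.Pairwise (· ≥ ·) ∧ ∀ x ∈ l, 0 < x :=
  and_congr_left' List.isChain_iff_pairwise

lemma IsPartition.le_headD {l : List ℕ} (hl : IsPartition l) : ∀ x ∈ l, x ≤ l.headD 0 := by
  rcases l with _ | ⟨y, l⟩
  · simp
  · intro x hx
    rcases List.mem_cons.1 hx with rfl | hx
    · rfl
    · exact (List.pairwise_cons.1 hl.pairwise).1 x hx

lemma IsPartition.subHat {l : List ℕ} (hl : IsPartition l) (k : ℕ) :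
    IsPartition (subHat k l) := by
  rw [isPartition_iff] at *
  constructor
  · refine List.Pairwise.filter _ (hl.1.map _ fun a b hab => ?_)
    exact Nat.sub_le_sub_right hab k
  · intro x hx
    have := (List.mem_filter.1 hx).2
    simp only [ne_eq, decide_eq_true_eq] at this
    omega

lemma colHeight_subHat (k : ℕ) (l : List ℕ) (j : ℕ) :
    colHeight (subHat k l) j = colHeight l (k + j) := by
  rw [colHeight, colHeight, subHat, List.countP_filter, List.countP_map]
  refine List.countP_congr fun x _ => ?_
  simp
  omega

lemma headD_subHat (k : ℕ) (l : List ℕ) (hl : IsPartition l) :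
    (subHat k l).headD 0 = l.headD 0 - k := by
  rcases l with _ | ⟨x, l⟩
  · simp [subHat]
  · by_cases hx : x - k = 0
    · have : subHat k (x :: l) = [] := by
        simp only [subHat, List.filter_eq_nil_iff, List.mem_map]
        rintro _ ⟨y, hy, rfl⟩
        have := hl.le_headD y hy
        simp at this ⊢
        omega
      rw [this]
      simp [hx]
    · simp [subHat, hx]

lemma subHat_zero {l : List ℕ} (hl : IsPartition l) : subHat 0 l = l := by
  simp only [subHat, Nat.sub_zero, List.map_id']
  rw [List.filter_eq_self]
  intro x hx
  have := hl.2 x hx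
  simp
  omega

lemma chiExp_X_pow_mul (k n : ℕ) {p : MvPolynomial ℕ ℤ} (hp : pderiv k p = 0) :
    chiExp (X k ^ n * p) = odf n * chiExp p := by
  induction n with
  | zero => simp [odf_zero]
  | succ n ih =>
    rw [pow_succ', mul_assoc, chiExp_X_mul, pderiv_mul, hp, pderiv_pow, pderiv_X_self, mul_zero,
      add_zero, ih, odf_succ]
    rcases n with _ | n
    · simp
    · have : X k * (((n + 1 : ℕ) : MvPolynomial ℕ ℤ) * X k ^ (n + 1 - 1) * 1 * p)
          = ((n + 1 : ℕ) : ℤ) • (X k ^ (n + 1) * p) := by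
        rw [zsmul_eq_mul, Nat.add_sub_cancel]
        push_cast
        ring
      rw [this, map_smul, ih, smul_eq_mul]
      push_cast
      ring

lemma chiExp_shiftSum_one_pow (d : ℕ → ℤ) (hd0 : d 0 = 1) (hd1 : d 1 = 0)
    (hd : ∀ n : ℕ, 2 ≤ n → d n = 2 * ((n : ℤ) - 1) * (d (n - 1) + d (n - 2))) (m : ℕ) :
    chiExp (shiftSum 1 ^ m) = d m := by
  induction m using Nat.strong_induction_on with
  | _ m ih =>
    rcases m with _ | _ | m
    · simp [chiExp_one, hd0]
    · simp [chiExp_shiftSum, hd1]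
    · have h1 : chiExp (X 0 * shiftSum 1 ^ m)
          = chiExp (shiftSum 1 ^ (m + 1)) + chiExp (shiftSum 1 ^ m) := by
        have := chiExp_shiftSum_mul 1 (shiftSum 1 ^ m)
        rw [Finset.sum_range_one, ← pow_succ'] at this
        linarith
      have h2 : X 0 * (((m + 1 : ℕ) : MvPolynomial ℕ ℤ) * shiftSum 1 ^ (m + 1 - 1) * 1)
          = ((m + 1 : ℕ) : ℤ) • (X 0 * shiftSum 1 ^ m) := by
        rw [zsmul_eq_mul, Nat.add_sub_cancel]
        push_cast
        ring
      rw [pow_succ', chiExp_shiftSum_mul, Finset.sum_range_one, chiExp_X_mul, pderiv_pow,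
        pderiv_shiftSum, if_pos (Nat.zero_lt_one), h2, map_smul, h1, ih m (by omega),
        ih (m + 1) (by omega), hd (m + 1 + 1) (by omega), smul_eq_mul]
      simp only [show m + 1 + 1 - 2 = m by omega,
        show m + 1 + 1 - 1 = m + 1 by omega]
      push_cast
      ring

/-- Expansion of the columns of `μ ++ [m]` along the last row. -/
lemma chiExp_colProd_concat (μ : List ℕ) (m : ℕ) (hne : μ ≠ []) (hμ : IsPartition μ)
    (hm : ∀ x ∈ μ, m ≤ x) :
    chiExp (colProd (colHeight (μ ++ [m])) (Finset.range (μ.headD 0)))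
      = ∑ k ∈ Finset.range (m + 1), (m.choose k : ℤ) * odf k *
        chiExp (colProd (colHeight (subHat k μ)) (Finset.range ((subHat k μ).headD 0))) := by
  set u := μ.headD 0 with hu
  have hmu : m ≤ u := by
    rcases μ with _ | ⟨x, l⟩
    · exact absurd rfl hne
    · exact hm x (by simp)
  have hfull : ∀ j < m, colHeight μ j = μ.length := fun j hj => by
    rw [colHeight, List.countP_eq_length]
    intro x hx
    have := hm x hx
    simp only [decide_eq_true_eq]
    omega
  have hlen : ∀ j, colHeight μ j ≤ μ.length := fun j => List.countP_le_length
  have happ (j : ℕ) : colHeight (μ ++ [m]) j = colHeight μ j + if j < m then 1 else 0 := by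
    simp [colHeight, List.countP_append, List.countP_cons]
  have hsplit : ∀ k ≤ m, colProd (colHeight μ) (Finset.Ico k u)
      = shiftSum μ.length ^ (m - k) * colProd (colHeight μ) (Finset.Ico m u) := by
    intro k hk
    rw [colProd, colProd, ← Finset.prod_Ico_consecutive _ hk hmu]
    congr 1
    rw [Finset.prod_congr rfl fun j hj => by rw [hfull j (Finset.mem_Ico.1 hj).2]]
    simp
  have hL : colProd (colHeight (μ ++ [m])) (Finset.range u)
      = shiftSum (μ.length + 1) ^ m * colProd (colHeight μ) (Finset.Ico m u) := by
    rw [colProd, colProd, Finset.range_eq_Ico, ← Finset.prod_Ico_consecutive _ (Nat.zero_le m) hmu]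
    congr 1
    · rw [Finset.prod_congr rfl fun j hj => by
        rw [happ, hfull j (Finset.mem_Ico.1 hj).2, if_pos (Finset.mem_Ico.1 hj).2]]
      simp
    · refine Finset.prod_congr rfl fun j hj => ?_
      rw [happ, if_neg (not_lt.2 (Finset.mem_Ico.1 hj).1), add_zero]
  have hR (k : ℕ) : colProd (colHeight (subHat k μ)) (Finset.range ((subHat k μ).headD 0))
      = colProd (colHeight μ) (Finset.Ico k u) := by
    rw [headD_subHat k μ hμ, colProd, colProd, Finset.prod_Ico_eq_prod_range]
    simp only [colHeight_subHat, hu]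
  rw [hL, shiftSum_succ, add_comm, add_pow, Finset.sum_mul, map_sum]
  refine Finset.sum_congr rfl fun k hk => ?_
  have hkm : k ≤ m := Nat.lt_succ_iff.1 (Finset.mem_range.1 hk)
  have hp : pderiv μ.length (colProd (colHeight μ) (Finset.Ico k u)) = 0 := by
    rw [pderiv_colProd]
    exact Finset.sum_eq_zero fun j _ => if_neg (not_lt.2 (hlen j))
  have e : X μ.length ^ k * shiftSum μ.length ^ (m - k) * (m.choose k : MvPolynomial ℕ ℤ)
      * colProd (colHeight μ) (Finset.Ico m u)
      = (m.choose k : ℤ) • (X μ.length ^ k * colProd (colHeight μ) (Finset.Ico k u)) := by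
    rw [hsplit k hkm, zsmul_eq_mul]
    push_cast
    ring
  rw [e, map_smul, chiExp_X_pow_mul _ _ hp, hR, smul_eq_mul, mul_assoc]

/-- The recursively defined function is the expectation of the product over columns. -/
lemma eq_chiExp_colProd (d : ℕ → ℤ) (hd0 : d 0 = 1) (hd1 : d 1 = 0)
    (hd : ∀ n : ℕ, 2 ≤ n → d n = 2 * ((n : ℤ) - 1) * (d (n - 1) + d (n - 2)))
    (f : List ℕ → ℤ) (hf0 : f [] = 1) (hf1 : ∀ m : ℕ, f [m] = d m)
    (hfr : ∀ l : List ℕ, IsPartition l → 2 ≤ l.length →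
      f l = f l.dropLast + ∑ k ∈ Finset.Icc 1 (l.getLastD 0),
        ((l.getLastD 0).choose k : ℤ) * odf k * f (subHat k l.dropLast))
    (l : List ℕ) (hl : IsPartition l) :
    f l = chiExp (colProd (colHeight l) (Finset.range (l.headD 0))) := by
  induction hN : l.length using Nat.strong_induction_on generalizing l with
  | _ N ih =>
  subst hN
  rcases l.eq_nil_or_concat' with rfl | ⟨μ, m, rfl⟩
  · simp [hf0, colProd, chiExp_one]
  rcases eq_or_ne μ [] with rfl | hne
  · have : colProd (colHeight [m]) (Finset.range m) = shiftSum 1 ^ m := by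
      rw [colProd, Finset.prod_congr rfl fun j hj => by
        rw [colHeight_cons, if_pos (Finset.mem_range.1 hj)]]
      simp [colHeight]
    simp only [List.nil_append, List.headD_cons, this, hf1]
    exact (chiExp_shiftSum_one_pow d hd0 hd1 hd m).symm
  have hl' := isPartition_iff.1 hl
  have hpw := List.pairwise_append.1 hl'.1
  have hμ : IsPartition μ := isPartition_iff.2 ⟨hpw.1, fun x hx => hl'.2 x (by simp [hx])⟩
  have hhead : (μ ++ [m]).headD 0 = μ.headD 0 := by
    rcases μ with _ | ⟨x, μ⟩
    · exact absurd rfl hne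
    · rfl
  have hlen : 0 < μ.length := List.length_pos_iff.2 hne
  have hsub (k : ℕ) : f (subHat k μ) = chiExp (colProd (colHeight (subHat k μ))
      (Finset.range ((subHat k μ).headD 0))) := by
    refine ih _ ?_ _ (hμ.subHat k) rfl
    have : (subHat k μ).length ≤ (μ.map fun x => x - k).length := List.length_filter_le _ _
    rw [List.length_map] at this
    rw [List.length_append, List.length_singleton]
    omega
  rw [hhead, chiExp_colProd_concat μ m hne hμ fun x hx => hpw.2.2 x hx m (by simp),
    hfr _ hl (by simp; omega), Finset.range_eq_Ico,
    Finset.sum_eq_sum_Ico_succ_bot (Nat.succ_pos m)]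
  simp only [← hsub, subHat_zero hμ, List.dropLast_concat, List.getLastD_concat, odf_zero,
    Nat.choose_zero_right]
  rw [show Finset.Icc 1 m = Finset.Ico (0 + 1) (m + 1) by
    ext; simp [Nat.succ_le_iff]]
  have h0 := hsub 0
  rw [subHat_zero hμ] at h0
  simp [h0]

lemma IsPartition.ext_getD {l l' : List ℕ} (hl : IsPartition l) (hl' : IsPartition l')
    (h : ∀ i, l.getD i 0 = l'.getD i 0) : l = l' := by
  have key {a b : List ℕ} (ha : IsPartition a) (hab : ∀ i, a.getD i 0 = b.getD i 0) :
      a.length ≤ b.length := by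
    by_contra! hlt
    have h1 := hab b.length
    rw [List.getD_eq_getElem _ _ hlt, List.getD_eq_default _ _ le_rfl] at h1
    exact absurd (ha.2 _ (List.getElem_mem hlt)) (by omega)
  refine List.ext_getElem (le_antisymm (key hl h) (key hl' fun i => (h i).symm)) fun i h1 h2 => ?_
  have := h i
  rwa [List.getD_eq_getElem _ _ h1, List.getD_eq_getElem _ _ h2] at this

lemma one_le_colHeight {l : List ℕ} {j : ℕ} (hj : j < l.headD 0) : 1 ≤ colHeight l j := by
  rcases l with _ | ⟨x, l⟩
  · simp at hj
  · rw [colHeight_cons, if_pos (by simpa using hj)]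
    omega

lemma colHeight_eq_one_iff {l : List ℕ} {j : ℕ} (hj : j < l.headD 0) :
    colHeight l j = 1 ↔ ∀ x ∈ l.tail, x ≤ j := by
  rcases l with _ | ⟨x, l⟩
  · simp at hj
  · rw [colHeight_cons, if_pos (by simpa using hj), List.tail_cons, ← colHeight_eq_zero_iff]
    omega

end

theorem stmt11
    (d : Nat → Int) (hd0 : d 0 = 1) (hd1 : d 1 = 0)
    (hd : ∀ n : Nat, 2 ≤ n → d n = 2 * ((n : Int) - 1) * (d (n - 1) + d (n - 2)))
    (f : List Nat → Int) (hf0 : f [] = 1) (hf1 : ∀ m : Nat, f [m] = d m)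
    (hfr : ∀ l : List Nat, IsPartition l → 2 ≤ l.length →
      f l = f l.dropLast + ∑ k ∈ Finset.Icc 1 (l.getLastD 0),
        ((l.getLastD 0).choose k : Int) * odf k * f (subHat k l.dropLast))
    (n u : Nat) (hn : 1 ≤ n)
    (lam lam' : List Nat) (hlam : IsPartition lam) (hlam' : IsPartition lam')
    (hsum : lam.sum = n) (hsum' : lam'.sum = n)
    (hhead : lam.headD 0 = u) (hhead' : lam'.headD 0 = u)
    (hdom : ∀ k : Nat, ∑ t ∈ Finset.range k, lam.getD t 0 ≤ ∑ t ∈ Finset.range k, lam'.getD t 0)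
    (hne : lam ≠ lam') :
    f lam ≤ f lam'
      ∧ (f lam = f lam' ↔ u = 3 ∧ (∀ x ∈ lam.tail, x ≤ 2) ∧ (∀ x ∈ lam'.tail, x ≤ 2)) := by
  subst hhead
  have hF := eq_chiExp_colProd d hd0 hd1 hd f hf0 hf1 hfr
  rw [hF lam hlam, hF lam' hlam', hhead']
  set u := lam.headD 0 with hu
  set s := Finset.range u with hs
  have h1 : ∀ i ∈ s, 1 ≤ colHeight lam i := fun i hi =>
    one_le_colHeight (Finset.mem_range.1 hi)
  have h1' : ∀ i ∈ s, 1 ≤ colHeight lam' i := fun i hi =>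
    one_le_colHeight (hhead' ▸ Finset.mem_range.1 hi)
  have hψ (c : ℕ) : ∑ i ∈ s, (colHeight lam i - c) + ∑ t ∈ Finset.range c, lam.getD t 0 = n :=
    (sum_colHeight_sub_add u lam hlam.pairwise hlam.le_headD c).trans hsum
  have hψ' (c : ℕ) : ∑ i ∈ s, (colHeight lam' i - c) + ∑ t ∈ Finset.range c, lam'.getD t 0 = n :=
    (sum_colHeight_sub_add u lam' hlam'.pairwise (hhead' ▸ hlam'.le_headD) c).trans hsum'
  have hle : ∀ c, ∑ i ∈ s, (colHeight lam' i - c) ≤ ∑ i ∈ s, (colHeight lam i - c) := by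
    intro c
    have := hψ c
    have := hψ' c
    have := hdom c
    omega
  have hsum0 : ∑ i ∈ s, colHeight lam' i = ∑ i ∈ s, colHeight lam i := by
    have e1 := hψ 0
    have e2 := hψ' 0
    simp only [Nat.sub_zero, Finset.range_zero, Finset.sum_empty, add_zero] at e1 e2
    omega
  have hlt : ∃ c, ∑ i ∈ s, (colHeight lam' i - c) < ∑ i ∈ s, (colHeight lam i - c) := by
    by_contra! hcon
    refine hne (hlam.ext_getD hlam' fun i => ?_)
    have hp (c : ℕ) : ∑ t ∈ Finset.range c, lam.getD t 0 = ∑ t ∈ Finset.range c, lam'.getD t 0 := by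
      have := hψ c
      have := hψ' c
      have := hcon c
      have := hle c
      omega
    have e := hp (i + 1)
    rw [Finset.sum_range_succ, Finset.sum_range_succ, hp i] at e
    omega
  obtain ⟨hmain, hstrict⟩ := chiExp_colProd_le_of_dom s (colHeight lam') h1' (colHeight lam) h1
    hle hsum0
  have htail : ∀ l : List ℕ, l.headD 0 = 3 →
      ((∃ i < 3, colHeight l i = 1) ↔ ∀ x ∈ l.tail, x ≤ 2) := by
    intro l hl
    constructor
    · rintro ⟨i, hi, h⟩ x hx
      have := (colHeight_eq_one_iff (hl ▸ hi)).1 h x hx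
      omega
    · exact fun h => ⟨2, by omega, (colHeight_eq_one_iff (by omega)).2 h⟩
  refine ⟨hmain, fun heq => ?_, ?_⟩
  · by_contra hcon
    refine (hstrict hlt ?_).ne heq
    rintro ⟨hcard, i, hi, hi1⟩
    rw [hs, Finset.card_range] at hcard
    rw [hs, Finset.mem_range] at hi
    have ht' := (htail lam' (hhead'.trans hcard)).1 ⟨i, by omega, hi1⟩
    refine hcon ⟨hcard, ?_, ht'⟩
    have hd2 := hdom 2
    rcases lam with _ | ⟨x, _ | ⟨y, l⟩⟩
    · simp
    · simp
    rcases lam' with _ | ⟨x', _ | ⟨y', l'⟩⟩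
    · exact absurd (hhead'.trans hcard) (by simp)
    · simp [Finset.sum_range_succ] at hd2 hhead' hu
      have := hlam.2 y (by simp)
      omega
    · simp [Finset.sum_range_succ] at hd2 hhead' hu
      have hy' : y' ≤ 2 := ht' y' (by simp)
      intro z hz
      have hp := (List.pairwise_cons.1 (List.pairwise_cons.1 hlam.pairwise).2).1
      rcases List.mem_cons.1 hz with rfl | hz
      · omega
      · have := hp z hz
        omega
  · rintro ⟨hu3, ht, ht'⟩
    have e (l : List ℕ) (hl : l.headD 0 = 3) (ht : ∀ x ∈ l.tail, x ≤ 2) :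
        chiExp (colProd (colHeight l) (Finset.range 3))
          = 2 * ((∑ i ∈ Finset.range 3, colHeight l i : ℕ) + 1) := by
      have e2 : colHeight l 2 = 1 := (colHeight_eq_one_iff (by omega)).2 ht
      have e0 := chiExp_shiftSum_one_mul (one_le_colHeight (l := l) (j := 0) (by omega))
        (one_le_colHeight (l := l) (j := 1) (by omega))
      simp only [colProd, Finset.prod_range_succ, Finset.prod_range_zero, one_mul,
        Finset.sum_range_succ, Finset.sum_range_zero, zero_add, e2]
      rw [mul_comm, e0]
      push_cast
      ring
    rw [hs, hu3] at hsum0 ⊢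
    rw [e lam hu3 ht, e lam' (hhead'.trans hu3) ht', hsum0]
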